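/- arXiv:1603.02295 — 6 statements merged into one kernel-verified Lean document; each statement's English description precedes it below -/
import Mathlib

section
/- For every ξ ∈ ℝ³, the fundamental solution Γ_ξ(η) = 1/(8π d(ξ,η)²) is Kohn-harmonic away from its pole: Δ_ℍ Γ_ξ(η) = 0 for every η ∈ ℝ³ with η ≠ ξ. -/
open MeasureTheory Real Set

noncomputable section

/-- The underlying space of the Heisenberg group ℍ¹: ℝ³ with coordinates (x, y, t). -/
abbrev H1 : Type := ℝ × ℝ × ℝ

/-- The Koranyi norm ρ(x,y,t) = ((x²+y²)² + t²)^{1/4}. -/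
def ρH (η : H1) : ℝ := ((η.1 ^ 2 + η.2.1 ^ 2) ^ 2 + η.2.2 ^ 2) ^ ((1 : ℝ) / 4)

/-- The Heisenberg group law: η∘ξ = (x+x₀, y+y₀, t+t₀+2(x₀y − x y₀)). -/
def hmul (η ξ : H1) : H1 :=
  (η.1 + ξ.1, η.2.1 + ξ.2.1, η.2.2 + ξ.2.2 + 2 * (ξ.1 * η.2.1 - η.1 * ξ.2.1))

/-- The Heisenberg group inverse: ξ⁻¹ = (−x₀,−y₀,−t₀). -/
def hinv (ξ : H1) : H1 := (-ξ.1, -ξ.2.1, -ξ.2.2)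

/-- The Koranyi distance d(ξ,η) = ρ(ξ⁻¹∘η). -/
def kd (ξ η : H1) : ℝ := ρH (hmul (hinv ξ) η)

/-- The Koranyi ball B(ξ,r) = {η : d(ξ,η) < r}. -/
def kball (ξ : H1) (r : ℝ) : Set H1 := {η | kd ξ η < r}

/-- Horizontal derivative Xu = ∂u/∂x + 2y·∂u/∂t, as the derivative along (1,0,2y). -/
def Xd (u : H1 → ℝ) (η : H1) : ℝ := fderiv ℝ u η (1, 0, 2 * η.2.1)

/-- Horizontal derivative Yu = ∂u/∂y − 2x·∂u/∂t, as the derivative along (0,1,−2x). -/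
def Yd (u : H1 → ℝ) (η : H1) : ℝ := fderiv ℝ u η (0, 1, -2 * η.1)

/-- The Kohn-Laplacian Δ_ℍ u = X(Xu) + Y(Yu). -/
def kohn (u : H1 → ℝ) (η : H1) : ℝ := Xd (Xd u) η + Yd (Yd u) η

/-- The fundamental solution with pole ξ: Γ_ξ(η) = 1/(8π d(ξ,η)²). -/
def Γξ (ξ η : H1) : ℝ := 1 / (8 * π * kd ξ η ^ 2)

/-- A set A satisfies the uniform exterior ball property if there exists r₀ > 0 such that
for every ζ ∈ ∂A and every r ∈ (0,r₀] there exists η with B(η,r) ∩ A = ∅ and ζ ∈ ∂B(η,r). -/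
def uebp (A : Set H1) : Prop :=
  ∃ r₀ > (0 : ℝ), ∀ ζ ∈ frontier A, ∀ r : ℝ, 0 < r → r ≤ r₀ →
    ∃ η : H1, kball η r ∩ A = ∅ ∧ ζ ∈ frontier (kball η r)

/-- Ω has C¹ boundary: it is the sublevel set of a C¹ defining function with
nonvanishing gradient on the boundary. -/
def c1Bdry (Ω : Set H1) : Prop :=
  ∃ f : H1 → ℝ, ContDiff ℝ 1 f ∧ Ω = {x | f x < 0} ∧
    frontier Ω = {x | f x = 0} ∧ ∀ x ∈ frontier Ω, fderiv ℝ f x ≠ 0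

/-- Ω has smooth boundary: it is the sublevel set of a smooth defining function with
nonvanishing gradient on the boundary. -/
def smoothBdry (Ω : Set H1) : Prop :=
  ∃ f : H1 → ℝ, ContDiff ℝ (⊤ : ℕ∞) f ∧ Ω = {x | f x < 0} ∧
    frontier Ω = {x | f x = 0} ∧ ∀ x ∈ frontier Ω, fderiv ℝ f x ≠ 0

/-- The horizontal perimeter of Ω:
P_ℍ(Ω) = sup { ∫_Ω (Xa + Yb) : a,b of class C¹ with a²+b² ≤ 1 }. -/
def horizPerim (Ω : Set H1) : ℝ :=
  sSup { p : ℝ | ∃ a b : H1 → ℝ, ContDiff ℝ 1 a ∧ ContDiff ℝ 1 b ∧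
    (∀ η, a η ^ 2 + b η ^ 2 ≤ 1) ∧ p = ∫ η in Ω, (Xd a η + Yd b η) }

/-- The first Dirichlet eigenvalue of the Kohn-Laplacian on Ω, via the Rayleigh quotient. -/
def lam1 (Ω : Set H1) : ℝ :=
  sInf { q : ℝ | ∃ v : H1 → ℝ, ContDiff ℝ (⊤ : ℕ∞) v ∧ HasCompactSupport v ∧ tsupport v ⊆ Ω ∧
    v ≠ 0 ∧ q = (∫ η in Ω, ((Xd v η) ^ 2 + (Yd v η) ^ 2)) / (∫ η in Ω, (v η) ^ 2) }

/-- The Bessel function of the first kind of order 1,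
J₁(l) = (l/2)·Σ_{k=0}^∞ ((−1)^k/(k!·(k+1)!))·(l/2)^{2k}. -/
def J1 (l : ℝ) : ℝ :=
  (l / 2) * ∑' k : ℕ,
    ((-1 : ℝ) ^ k / ((Nat.factorial k : ℝ) * (Nat.factorial (k + 1) : ℝ))) * (l / 2) ^ (2 * k)

/-- The fourth power of the Koranyi distance to `ξ`. -/
def koranyiPow (ξ ζ : H1) : ℝ :=
  ((ζ.1 - ξ.1) ^ 2 + (ζ.2.1 - ξ.2.1) ^ 2) ^ 2 +
    (ζ.2.2 - ξ.2.2 + 2 * (ξ.1 * ζ.2.1 - ζ.1 * ξ.2.1)) ^ 2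

/-- The horizontal derivative along `X` of the gauge power. -/
def koranyiPowX (ξ ζ : H1) : ℝ :=
  4 * (ζ.1 - ξ.1) * ((ζ.1 - ξ.1) ^ 2 + (ζ.2.1 - ξ.2.1) ^ 2) +
    4 * (ζ.2.1 - ξ.2.1) * (ζ.2.2 - ξ.2.2 + 2 * (ξ.1 * ζ.2.1 - ζ.1 * ξ.2.1))

/-- The horizontal derivative along `Y` of the gauge power. -/
def koranyiPowY (ξ ζ : H1) : ℝ :=
  4 * (ζ.2.1 - ξ.2.1) * ((ζ.1 - ξ.1) ^ 2 + (ζ.2.1 - ξ.2.1) ^ 2) -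
    4 * (ζ.1 - ξ.1) * (ζ.2.2 - ξ.2.2 + 2 * (ξ.1 * ζ.2.1 - ζ.1 * ξ.2.1))

theorem koranyiPow_nonneg (ξ ζ : H1) : 0 ≤ koranyiPow ξ ζ := by
  unfold koranyiPow; positivity

theorem koranyiPow_pos {ξ ζ : H1} (h : ζ ≠ ξ) : 0 < koranyiPow ξ ζ := by
  refine lt_of_le_of_ne (koranyiPow_nonneg ξ ζ) fun h0 => h ?_
  unfold koranyiPow at h0
  have h1 : (ζ.1 - ξ.1) ^ 2 + (ζ.2.1 - ξ.2.1) ^ 2 = 0 := by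
    refine pow_eq_zero_iff two_ne_zero |>.1 (le_antisymm ?_ (by positivity))
    nlinarith [sq_nonneg (ζ.2.2 - ξ.2.2 + 2 * (ξ.1 * ζ.2.1 - ζ.1 * ξ.2.1))]
  have hx : ζ.1 = ξ.1 := by nlinarith [sq_nonneg (ζ.1 - ξ.1), sq_nonneg (ζ.2.1 - ξ.2.1)]
  have hy : ζ.2.1 = ξ.2.1 := by nlinarith [sq_nonneg (ζ.1 - ξ.1), sq_nonneg (ζ.2.1 - ξ.2.1)]
  have ht : ζ.2.2 = ξ.2.2 := by
    rw [hx, hy] at h0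
    nlinarith
  exact Prod.ext hx (Prod.ext hy ht)

theorem Γξ_eq (ξ ζ : H1) :
    Γξ ξ ζ = (8 * π)⁻¹ * koranyiPow ξ ζ ^ (-(1 / 2) : ℝ) := by
  have h : kd ξ ζ = koranyiPow ξ ζ ^ ((1 : ℝ) / 4) := by
    simp only [kd, ρH, hmul, hinv, koranyiPow]
    congr 1
    ring
  have h2 : kd ξ ζ ^ 2 = koranyiPow ξ ζ ^ ((1 : ℝ) / 2) := by
    rw [h, ← Real.rpow_mul_natCast (koranyiPow_nonneg ξ ζ)]
    norm_num
  rw [Γξ, h2, Real.rpow_neg (koranyiPow_nonneg ξ ζ), one_div, mul_inv]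

theorem hasFDerivAt_coords (ξ ζ : H1) :
    ∃ A B C : H1 →L[ℝ] ℝ,
      HasFDerivAt (fun z : H1 => z.1 - ξ.1) A ζ ∧
      HasFDerivAt (fun z : H1 => z.2.1 - ξ.2.1) B ζ ∧
      HasFDerivAt (fun z : H1 => z.2.2 - ξ.2.2 + 2 * (ξ.1 * z.2.1 - z.1 * ξ.2.1)) C ζ ∧
      ∀ v : H1, A v = v.1 ∧ B v = v.2.1 ∧
        C v = v.2.2 + 2 * (ξ.1 * v.2.1 - v.1 * ξ.2.1) := by
  have h1 : HasFDerivAt (𝕜 := ℝ) (fun z : H1 => z.1) _ ζ := hasFDerivAt_fst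
  have h2 : HasFDerivAt (𝕜 := ℝ) (fun z : H1 => z.2.1) _ ζ := (hasFDerivAt_snd (p := ζ)).fst
  have h3 : HasFDerivAt (𝕜 := ℝ) (fun z : H1 => z.2.2) _ ζ := (hasFDerivAt_snd (p := ζ)).snd
  refine ⟨_, _, _, h1.sub_const _, h2.sub_const _,
    (h3.sub_const _).fun_add (((h2.const_mul ξ.1).fun_sub (h1.mul_const ξ.2.1)).const_mul 2),
    fun v => ⟨by simp, by simp, ?_⟩⟩
  simp
  ring

theorem hasFDerivAt_koranyiPow (ξ ζ : H1) :
    ∃ L : H1 →L[ℝ] ℝ, HasFDerivAt (koranyiPow ξ) L ζ ∧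
      L (1, 0, 2 * ζ.2.1) = koranyiPowX ξ ζ ∧ L (0, 1, -2 * ζ.1) = koranyiPowY ξ ζ := by
  obtain ⟨A, B, C, hA, hB, hC, h⟩ := hasFDerivAt_coords ξ ζ
  refine ⟨_, (HasFDerivAt.pow ((HasFDerivAt.pow hA 2).fun_add (HasFDerivAt.pow hB 2)) 2).fun_add
     (HasFDerivAt.pow hC 2), ?_, ?_⟩
  · simp [h, koranyiPowX]
    ring
  · simp [h, koranyiPowY]
    ring

theorem hasFDerivAt_koranyiPowX (ξ ζ : H1) :
    ∃ L : H1 →L[ℝ] ℝ, HasFDerivAt (koranyiPowX ξ) L ζ ∧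
      L (1, 0, 2 * ζ.2.1) = 12 * ((ζ.1 - ξ.1) ^ 2 + (ζ.2.1 - ξ.2.1) ^ 2) := by
  obtain ⟨A, B, C, hA, hB, hC, h⟩ := hasFDerivAt_coords ξ ζ
  refine ⟨_, ((hA.const_mul 4).fun_mul ((HasFDerivAt.pow hA 2).fun_add (HasFDerivAt.pow hB 2))).fun_add
    ((hB.const_mul 4).fun_mul hC), ?_⟩
  simp [h]
  ring

theorem hasFDerivAt_koranyiPowY (ξ ζ : H1) :
    ∃ L : H1 →L[ℝ] ℝ, HasFDerivAt (koranyiPowY ξ) L ζ ∧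
      L (0, 1, -2 * ζ.1) = 12 * ((ζ.1 - ξ.1) ^ 2 + (ζ.2.1 - ξ.2.1) ^ 2) := by
  obtain ⟨A, B, C, hA, hB, hC, h⟩ := hasFDerivAt_coords ξ ζ
  refine ⟨_, ((hB.const_mul 4).fun_mul ((HasFDerivAt.pow hA 2).fun_add (HasFDerivAt.pow hB 2))).fun_sub
    ((hA.const_mul 4).fun_mul hC), ?_⟩
  simp [h]
  ring

theorem koranyiPowX_sq_add_koranyiPowY_sq (ξ ζ : H1) :
    koranyiPowX ξ ζ ^ 2 + koranyiPowY ξ ζ ^ 2 =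
      16 * ((ζ.1 - ξ.1) ^ 2 + (ζ.2.1 - ξ.2.1) ^ 2) * koranyiPow ξ ζ := by
  unfold koranyiPowX koranyiPowY koranyiPow
  ring

/-- First derivative of `Γξ` away from its pole, in terms of the derivative of the gauge power. -/
theorem fderiv_Γξ_apply {ξ ζ : H1} (hζ : ζ ≠ ξ) {L : H1 →L[ℝ] ℝ}
    (hL : HasFDerivAt (koranyiPow ξ) L ζ) (v : H1) :
    fderiv ℝ (Γξ ξ) ζ v =
      -(16 * π)⁻¹ * (koranyiPow ξ ζ ^ (-(3 / 2) : ℝ) * L v) := by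
  have h := (hL.rpow_const (p := (-(1 / 2) : ℝ)) (Or.inl (koranyiPow_pos hζ).ne')).const_mul
    ((8 * π)⁻¹)
  rw [funext (Γξ_eq ξ), h.fderiv]
  simp only [smul_apply, smul_eq_mul]
  rw [show (-(1 / 2) - 1 : ℝ) = -(3 / 2) by norm_num]
  field_simp
  ring

/-- Directional derivative of `N ^ (-3/2) * g` for the gauge power `N`. -/
theorem fderiv_rpow_koranyiPow_mul_apply {ξ ζ : H1} (hζ : ζ ≠ ξ) {L M : H1 →L[ℝ] ℝ} {g : H1 → ℝ}
    (hL : HasFDerivAt (koranyiPow ξ) L ζ) (hM : HasFDerivAt g M ζ) (c : ℝ) (v : H1) :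
    fderiv ℝ (fun z => c * (koranyiPow ξ z ^ (-(3 / 2) : ℝ) * g z)) ζ v =
      c * koranyiPow ξ ζ ^ (-(5 / 2) : ℝ) * (koranyiPow ξ ζ * M v - 3 / 2 * g ζ * L v) := by
  have hpos := koranyiPow_pos hζ
  have h := ((hL.rpow_const (p := (-(3 / 2) : ℝ)) (Or.inl hpos.ne')).fun_mul hM).const_mul c
  have hp : koranyiPow ξ ζ ^ (-(3 / 2) : ℝ) =
      koranyiPow ξ ζ ^ (-(5 / 2) : ℝ) * koranyiPow ξ ζ := by
    rw [← Real.rpow_add_one hpos.ne']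
    norm_num
  rw [h.fderiv]
  simp only [smul_apply, add_apply, smul_eq_mul]
  rw [show (-(3 / 2) - 1 : ℝ) = -(5 / 2) by norm_num, hp]
  ring

/-- The fundamental solution Γ_ξ(η) = 1/(8π d(ξ,η)²) is Kohn-harmonic
away from its pole. -/
theorem fundamental_solution_harmonic (ξ : H1) (η : H1) (hη : η ≠ ξ) :
    kohn (fun ζ => Γξ ξ ζ) η = 0 := by
  obtain ⟨L, hL, hLX, hLY⟩ := hasFDerivAt_koranyiPow ξ η
  obtain ⟨M, hM, hMX⟩ := hasFDerivAt_koranyiPowX ξ η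
  obtain ⟨K, hK, hKY⟩ := hasFDerivAt_koranyiPowY ξ η
  have hX : Xd (Γξ ξ) =ᶠ[nhds η] fun z =>
      -(16 * π)⁻¹ * (koranyiPow ξ z ^ (-(3 / 2) : ℝ) * koranyiPowX ξ z) := by
    filter_upwards [isOpen_ne.mem_nhds hη] with z hz
    obtain ⟨L, hL, hLX, -⟩ := hasFDerivAt_koranyiPow ξ z
    rw [Xd, fderiv_Γξ_apply hz hL, hLX]
  have hY : Yd (Γξ ξ) =ᶠ[nhds η] fun z =>
      -(16 * π)⁻¹ * (koranyiPow ξ z ^ (-(3 / 2) : ℝ) * koranyiPowY ξ z) := by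
    filter_upwards [isOpen_ne.mem_nhds hη] with z hz
    obtain ⟨L, hL, -, hLY⟩ := hasFDerivAt_koranyiPow ξ z
    rw [Yd, fderiv_Γξ_apply hz hL, hLY]
  change fderiv ℝ (Xd (Γξ ξ)) η _ + fderiv ℝ (Yd (Γξ ξ)) η _ = 0
  rw [hX.fderiv_eq, hY.fderiv_eq, fderiv_rpow_koranyiPow_mul_apply hη hL hM,
    fderiv_rpow_koranyiPow_mul_apply hη hL hK, hLX, hLY, hMX, hKY]
  linear_combination (3 / 2 * (16 * π)⁻¹ * koranyiPow ξ η ^ (-(5 / 2) : ℝ)) *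
    koranyiPowX_sq_add_koranyiPowY_sq ξ η
end
end

section
/- Let t₀ > 0, ξ = (0,0,t₀), and D = {(x,y,t) ∈ ℝ³ : t > 0}. Then the function h(η) = 1/(8π ρ(ξ∘η)²) satisfies Δ_ℍ h = 0 on D, and h(η) = 1/(8π ρ(ξ⁻¹∘η)²) for every η = (x,y,0) with t = 0. Consequently h(ξ) = 1/(16π t₀), so the harmonic radius of D at ξ, defined by r = 1/√(8π h(ξ)), equals √(2t₀). -/
open MeasureTheory Real Set

noncomputable section

/-- The quantity `ρ(ξ∘η)⁴` for `ξ = (0, 0, a)`. -/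
def quartic (a : ℝ) (η : H1) : ℝ := (η.1 ^ 2 + η.2.1 ^ 2) ^ 2 + (η.2.2 + a) ^ 2

theorem quartic_pos {a : ℝ} {η : H1} (h : 0 < η.2.2 + a) : 0 < quartic a η := by
  unfold quartic
  positivity

theorem ρH_hmul_sq (a : ℝ) (η : H1) : ρH (hmul (0, 0, a) η) ^ 2 = √(quartic a η) := by
  have h0 : 0 ≤ quartic a η := by
    unfold quartic
    positivity
  have h : ρH (hmul (0, 0, a) η) = quartic a η ^ ((1 : ℝ) / 4) := by
    simp only [ρH, hmul, quartic]
    congr 1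
    ring
  rw [h, ← rpow_natCast, ← rpow_mul h0, sqrt_eq_rpow]
  norm_num

theorem differentiable_quartic (a : ℝ) : Differentiable ℝ (quartic a) := by
  unfold quartic
  fun_prop

theorem fderiv_quartic (a : ℝ) (η v : H1) :
    fderiv ℝ (quartic a) η v =
      2 * (η.1 ^ 2 + η.2.1 ^ 2) * (2 * η.1 * v.1 + 2 * η.2.1 * v.2.1) +
        2 * (η.2.2 + a) * v.2.2 := by
  have h1 : HasFDerivAt (fun η : H1 => η.1) (ContinuousLinearMap.fst ℝ ℝ (ℝ × ℝ)) η :=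
    hasFDerivAt_fst
  have h2 : HasFDerivAt (fun η : H1 => η.2) (ContinuousLinearMap.snd ℝ ℝ (ℝ × ℝ)) η :=
    hasFDerivAt_snd
  have h := (((h1.pow 2).add (h2.fst.pow 2)).pow 2).add ((h2.snd.add_const a).pow 2)
  have h' : HasFDerivAt (quartic a) _ η := h
  rw [h'.fderiv]
  simp
  ring

theorem hasFDerivAt_inv_sqrt_quartic {a : ℝ} {η : H1} (h : 0 < η.2.2 + a) :
    HasFDerivAt (fun η => (√(quartic a η))⁻¹)
      ((-(1 / 2) * (√(quartic a η))⁻¹ ^ 3) • fderiv ℝ (quartic a) η) η := by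
  have hN := quartic_pos h
  have hs : √(quartic a η) ≠ 0 := (sqrt_pos.2 hN).ne'
  have hd := ((hasDerivAt_sqrt hN.ne').inv hs).comp_hasFDerivAt η
    (differentiable_quartic a η).hasFDerivAt
  refine hd.congr_fderiv ?_
  congr 1
  field_simp

/-- Second-order chain rule along a direction field for a multiple of `ρ(ξ∘η)⁻²`. -/
theorem fderiv_fderiv_inv_sqrt_quartic {a c : ℝ} {η : H1} (h : 0 < η.2.2 + a) (V : H1 → H1)
    {p : H1 → ℝ} (hp : ∀ ζ, fderiv ℝ (quartic a) ζ (V ζ) = p ζ) (hpd : DifferentiableAt ℝ p η) :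
    fderiv ℝ (fun ζ => fderiv ℝ (fun η => c * (√(quartic a η))⁻¹) ζ (V ζ)) η (V η) =
      c * (3 / 4 * (√(quartic a η))⁻¹ ^ 5 * p η ^ 2 -
        1 / 2 * (√(quartic a η))⁻¹ ^ 3 * fderiv ℝ p η (V η)) := by
  have hev : (fun ζ => fderiv ℝ (fun η => c * (√(quartic a η))⁻¹) ζ (V ζ)) =ᶠ[nhds η]
      fun ζ => -(c / 2) * ((√(quartic a ζ))⁻¹ ^ 3 * p ζ) := by
    have hopen : IsOpen {ζ : H1 | 0 < ζ.2.2 + a} :=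
      isOpen_lt continuous_const (by fun_prop)
    filter_upwards [hopen.mem_nhds h] with ζ hζ
    rw [((hasFDerivAt_inv_sqrt_quartic hζ).const_mul c).fderiv, ← hp]
    simp
    ring
  have hd : HasFDerivAt (fun ζ => -(c / 2) * ((√(quartic a ζ))⁻¹ ^ 3 * p ζ)) _ η :=
    (((hasFDerivAt_inv_sqrt_quartic h).pow 3).mul hpd.hasFDerivAt).const_mul (-(c / 2))
  rw [hev.fderiv_eq, hd.fderiv]
  simp [hp]
  ring

theorem kohn_inv_sqrt_quartic {a : ℝ} (c : ℝ) {η : H1} (h : 0 < η.2.2 + a) :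
    kohn (fun η => c * (√(quartic a η))⁻¹) η = 0 := by
  have h1 : HasFDerivAt (fun η : H1 => η.1) (ContinuousLinearMap.fst ℝ ℝ (ℝ × ℝ)) η :=
    hasFDerivAt_fst
  have h2 : HasFDerivAt (fun η : H1 => η.2) (ContinuousLinearMap.snd ℝ ℝ (ℝ × ℝ)) η :=
    hasFDerivAt_snd
  have hw := (h1.pow 2).add (h2.fst.pow 2)
  have hs := h2.snd.add_const a
  have hX := ((h1.mul hw).add (h2.fst.mul hs)).const_mul 4
  have hY := ((h2.fst.mul hw).sub (h1.mul hs)).const_mul 4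
  have eX := fderiv_fderiv_inv_sqrt_quartic (c := c) h (fun ζ => (1, 0, 2 * ζ.2.1))
    (fun ζ => by rw [fderiv_quartic]; simp; ring) hX.differentiableAt
  have eY := fderiv_fderiv_inv_sqrt_quartic (c := c) h (fun ζ => (0, 1, -2 * ζ.1))
    (fun ζ => by rw [fderiv_quartic]; simp; ring) hY.differentiableAt
  rw [hX.fderiv] at eX
  rw [hY.fderiv] at eY
  have hN := quartic_pos h
  have hg : quartic a η * (√(quartic a η))⁻¹ ^ 2 = 1 := by
    rw [inv_pow, sq_sqrt hN.le, mul_inv_cancel₀ hN.ne']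
  unfold kohn Xd Yd
  rw [eX, eY]
  generalize (√(quartic a η))⁻¹ = g at hg ⊢
  simp [quartic] at hg ⊢
  linear_combination (12 * c * g ^ 3 * (η.1 ^ 2 + η.2.1 ^ 2)) * hg

/-- For the half-space D = {t > 0} and ξ = (0,0,t₀), the function
h(η) = 1/(8π ρ(ξ∘η)²) is Kohn-harmonic on D, equals Γ_ξ on ∂D = {t = 0},
h(ξ) = 1/(16π t₀), and the harmonic radius 1/√(8π h(ξ)) equals √(2t₀). -/
theorem half_space_harmonic_radius (t₀ : ℝ) (ht₀ : 0 < t₀) :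
    let ξ : H1 := (0, 0, t₀)
    let h : H1 → ℝ := fun η => 1 / (8 * π * ρH (hmul ξ η) ^ 2)
    (∀ η : H1, 0 < η.2.2 → kohn h η = 0) ∧
    (∀ x y : ℝ, h (x, y, 0) = 1 / (8 * π * ρH (hmul (hinv ξ) (x, y, 0)) ^ 2)) ∧
    h ξ = 1 / (16 * π * t₀) ∧
    1 / Real.sqrt (8 * π * h ξ) = Real.sqrt (2 * t₀) := by
  intro ξ h
  have hh : h = fun η => 1 / (8 * π) * (√(quartic t₀ η))⁻¹ := by
    funext η
    simp only [h, ξ, ρH_hmul_sq]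
    rw [one_div, one_div, mul_inv]
  have hξ : h ξ = 1 / (16 * π * t₀) := by
    have hq : quartic t₀ ξ = (2 * t₀) ^ 2 := by
      simp only [quartic, ξ]
      ring
    simp only [hh]
    rw [hq, sqrt_sq (by positivity)]
    field_simp
    norm_num
  refine ⟨fun η hη => ?_, fun x y => ?_, hξ, ?_⟩
  · rw [hh]
    exact kohn_inv_sqrt_quartic _ (by positivity)
  · simp [h, ξ, hinv, ρH, hmul]
  · have h8 : 8 * π * h ξ = (2 * t₀)⁻¹ := by
      rw [hξ]
      field_simp
      norm_num
    rw [h8, sqrt_inv, one_div, inv_inv]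
end
end

section
/- Let Ω ⊆ ℝ³ be a bounded open set, ξ ∈ Ω, and let H be a regular part of the Green's function of Ω at ξ, i.e. H is continuous on the closure of Ω, twice continuously differentiable with Δ_ℍ H = 0 on Ω, and H(η) = Γ_ξ(η) for all η ∈ ∂Ω. Then the Green's function G_ξ = Γ_ξ − H is nonnegative on Ω ∖ {ξ}. -/
open MeasureTheory Real Set

noncomputable section

open Filter Topology

lemma nonneg_of_isLocalMin_of_hasDerivAt {f f' : ℝ → ℝ} {a : ℝ} {x : ℝ} (hmin : IsLocalMin f x)
    (hf : ∀ᶠ s in 𝓝 x, HasDerivAt f (f' s) s) (hf' : HasDerivAt f' a x) : 0 ≤ a := by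
  have hd : deriv f =ᶠ[𝓝 x] f' := hf.mono fun s hs => hs.deriv
  have hdd : deriv (deriv f) x = a := by rw [hd.deriv_eq, hf'.deriv]
  by_contra! ha
  have hmax := isLocalMax_of_deriv_deriv_neg (hdd ▸ ha) hmin.deriv_eq_zero
    hf.self_of_nhds.continuousAt
  have hconst : f =ᶠ[𝓝 x] fun _ => f x := by
    filter_upwards [hmin, hmax] with s h₁ h₂ using le_antisymm h₂ h₁
  have hzero : deriv (deriv f) x = 0 := by
    rw [(hconst.deriv).deriv_eq]
    simp
  linarith

lemma eventually_hasDerivAt_line {u : H1 → ℝ} {η : H1} (hu : ContDiffAt ℝ 2 u η) (v : H1) :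
    ∀ᶠ s in 𝓝 (0 : ℝ), HasDerivAt (fun s : ℝ => u (η + s • v)) (fderiv ℝ u (η + s • v) v) s := by
  have hline : Tendsto (fun s : ℝ => η + s • v) (𝓝 0) (𝓝 η) :=
    Continuous.tendsto' (by fun_prop) _ _ (by simp)
  filter_upwards [hline.eventually (hu.eventually (by simp))] with s hs
  have hl : HasDerivAt (fun s : ℝ => η + s • v) v s := by
    simpa using ((hasDerivAt_id s).smul_const v).const_add η
  exact (hs.differentiableAt (by simp)).hasFDerivAt.comp_hasDerivAt s hl

lemma hasDerivAt_fderiv_line {u : H1 → ℝ} {η : H1} (hu : ContDiffAt ℝ 2 u η) {V : H1 → H1}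
    (hV : DifferentiableAt ℝ V η) (hVl : ∀ s : ℝ, V (η + s • V η) = V η) :
    HasDerivAt (fun s : ℝ => fderiv ℝ u (η + s • V η) (V η))
      (fderiv ℝ (fun ζ => fderiv ℝ u ζ (V ζ)) η (V η)) 0 := by
  have hd : DifferentiableAt ℝ (fun ζ => fderiv ℝ u ζ (V ζ)) η :=
    ((hu.fderiv_right (m := 1) (by norm_num)).differentiableAt (by simp)).clm_apply hV
  have hl : HasDerivAt (fun s : ℝ => η + s • V η) (V η) 0 := by
    simpa using ((hasDerivAt_id (0 : ℝ)).smul_const (V η)).const_add η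
  have hd' : HasFDerivAt (fun ζ => fderiv ℝ u ζ (V ζ))
      (fderiv ℝ (fun ζ => fderiv ℝ u ζ (V ζ)) η) (η + (0 : ℝ) • V η) := by
    simpa using hd.hasFDerivAt
  simpa only [Function.comp_def, hVl] using hd'.comp_hasDerivAt (0 : ℝ) hl

/-- The fourth power of the Koranyi distance to `ξ`. -/
def koranyiQuartic (ξ η : H1) : ℝ :=
  ((η.1 - ξ.1) ^ 2 + (η.2.1 - ξ.2.1) ^ 2) ^ 2 +
    (η.2.2 - ξ.2.2 + 2 * (ξ.1 * η.2.1 - η.1 * ξ.2.1)) ^ 2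

lemma koranyiQuartic_nonneg (ξ η : H1) : 0 ≤ koranyiQuartic ξ η := by
  unfold koranyiQuartic; positivity

lemma koranyiQuartic_pos {ξ η : H1} (h : η ≠ ξ) : 0 < koranyiQuartic ξ η := by
  refine (koranyiQuartic_nonneg ξ η).lt_of_ne' fun h0 => h ?_
  unfold koranyiQuartic at h0
  have h1 : ((η.1 - ξ.1) ^ 2 + (η.2.1 - ξ.2.1) ^ 2) = 0 := by
    refine pow_eq_zero_iff two_ne_zero |>.1 ?_
    nlinarith [sq_nonneg ((η.1 - ξ.1) ^ 2 + (η.2.1 - ξ.2.1) ^ 2),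
      sq_nonneg (η.2.2 - ξ.2.2 + 2 * (ξ.1 * η.2.1 - η.1 * ξ.2.1))]
  have hx : η.1 = ξ.1 := by
    nlinarith [sq_nonneg (η.1 - ξ.1), sq_nonneg (η.2.1 - ξ.2.1)]
  have hy : η.2.1 = ξ.2.1 := by
    nlinarith [sq_nonneg (η.1 - ξ.1), sq_nonneg (η.2.1 - ξ.2.1)]
  rw [h1, hx, hy] at h0
  have ht : η.2.2 = ξ.2.2 := by nlinarith [sq_nonneg (η.2.2 - ξ.2.2)]
  exact Prod.ext hx (Prod.ext hy ht)

lemma continuous_koranyiQuartic (ξ : H1) : Continuous (koranyiQuartic ξ) := by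
  unfold koranyiQuartic; fun_prop

lemma Γξ_eq_rpow (ξ η : H1) : Γξ ξ η = 1 / (8 * π) * koranyiQuartic ξ η ^ (-1 / 2 : ℝ) := by
  have hN := koranyiQuartic_nonneg ξ η
  have hkd : kd ξ η = koranyiQuartic ξ η ^ (1 / 4 : ℝ) := by
    unfold kd ρH hmul hinv koranyiQuartic
    congr 1
    ring
  have hsq : kd ξ η ^ 2 = koranyiQuartic ξ η ^ (1 / 2 : ℝ) := by
    rw [hkd, ← rpow_natCast, ← rpow_mul hN]
    norm_num
  rw [Γξ, hsq, neg_div, rpow_neg hN, one_div_mul_eq_div, ← one_div, div_div, mul_comm]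

lemma hasDerivAt_koranyi_line (a b c s : ℝ) :
    HasDerivAt (fun s : ℝ => ((a + s) ^ 2 + b ^ 2) ^ 2 + (c + 2 * b * s) ^ 2)
      (4 * (a + s) * ((a + s) ^ 2 + b ^ 2) + 4 * b * (c + 2 * b * s)) s := by
  have h₁ := (((((hasDerivAt_id s).const_add a).pow 2).add_const (b ^ 2)).pow 2).add
    ((((hasDerivAt_id s).const_mul (2 * b)).const_add c).pow 2)
  refine (h₁.congr_deriv ?_)
  simp
  ring

lemma hasDerivAt_koranyi_line' (a b c : ℝ) :
    HasDerivAt (fun s : ℝ => 4 * (a + s) * ((a + s) ^ 2 + b ^ 2) + 4 * b * (c + 2 * b * s))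
      (12 * (a ^ 2 + b ^ 2)) 0 := by
  have h₁ := ((((hasDerivAt_id (0 : ℝ)).const_add a).const_mul 4).mul
    ((((hasDerivAt_id (0 : ℝ)).const_add a).pow 2).add_const (b ^ 2))).add
    ((((hasDerivAt_id (0 : ℝ)).const_mul (2 * b)).const_add c).const_mul (4 * b))
  refine (h₁.congr_deriv ?_)
  simp
  ring

/-- First and second derivatives of `P ^ (-1/2)` in terms of those of `P`. -/
lemma hasDerivAt_rpow_neg_half {P P' : ℝ → ℝ} {P'' x : ℝ} (hpos : 0 < P x)
    (hP : ∀ s, HasDerivAt P (P' s) s) (hP' : HasDerivAt P' P'' x) :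
    (∀ᶠ s in 𝓝 x, HasDerivAt (fun s => P s ^ (-1 / 2 : ℝ))
        (P' s * (-1 / 2) * P s ^ (-3 / 2 : ℝ)) s) ∧
      HasDerivAt (fun s => P' s * (-1 / 2) * P s ^ (-3 / 2 : ℝ))
        ((3 / 4 * P' x ^ 2 - 1 / 2 * P x * P'') * P x ^ (-5 / 2 : ℝ)) x := by
  constructor
  · filter_upwards [(hP x).continuousAt.eventually (lt_mem_nhds hpos)] with s hs
    convert (hP s).rpow_const (p := -1 / 2) (Or.inl hs.ne') using 2
    norm_num
  · have h := (hP'.mul_const (-1 / 2)).mul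
      ((hP x).rpow_const (p := -3 / 2) (Or.inl hpos.ne'))
    refine h.congr_deriv ?_
    have e : P x ^ (-3 / 2 : ℝ) = P x * P x ^ (-5 / 2 : ℝ) := by
      rw [← rpow_one_add' hpos.le (by norm_num)]
      norm_num
    have e' : (-3 / 2 - 1 : ℝ) = -5 / 2 := by norm_num
    rw [e', e]
    ring

/-- Second derivative test at a minimum along a horizontal line, on which the fourth power of the
Koranyi distance is a quartic polynomial. -/
lemma second_order_along_horizontal_line {a b c : ℝ} (hpos : 0 < (a ^ 2 + b ^ 2) ^ 2 + c ^ 2)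
    {f h h' p p' : ℝ → ℝ} {h'' p'' : ℝ} (hmin : IsLocalMin f 0)
    (hf : ∀ s, f s = 1 / (8 * π) *
      (((a + s) ^ 2 + b ^ 2) ^ 2 + (c + 2 * b * s) ^ 2) ^ (-1 / 2 : ℝ) - h s + p s)
    (hh : ∀ᶠ s in 𝓝 0, HasDerivAt h (h' s) s) (hh' : HasDerivAt h' h'' 0)
    (hp : ∀ s, HasDerivAt p (p' s) s) (hp' : HasDerivAt p' p'' 0) :
    0 ≤ 1 / (8 * π) * ((3 / 4 * (4 * a * (a ^ 2 + b ^ 2) + 4 * b * c) ^ 2 -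
      1 / 2 * ((a ^ 2 + b ^ 2) ^ 2 + c ^ 2) * (12 * (a ^ 2 + b ^ 2))) *
      ((a ^ 2 + b ^ 2) ^ 2 + c ^ 2) ^ (-5 / 2 : ℝ)) - h'' + p'' := by
  obtain ⟨hΓ, hΓ'⟩ := hasDerivAt_rpow_neg_half (x := 0) (by simpa using hpos)
    (hasDerivAt_koranyi_line a b c) (hasDerivAt_koranyi_line' a b c)
  simp only [add_zero, mul_zero] at hΓ'
  obtain rfl : f = _ := funext hf
  refine nonneg_of_isLocalMin_of_hasDerivAt hmin ?_
    (((hΓ'.const_mul (1 / (8 * π))).sub hh').add hp')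
  filter_upwards [hΓ, hh] with s h₁ h₂
  exact ((h₁.const_mul (1 / (8 * π))).sub h₂).add (hp s)

/-- A minimum principle: a strictly horizontally superharmonic perturbation of `Γξ ξ - H` has no
local minimum away from the pole. -/
lemma not_isLocalMin_barrier {ξ η : H1} (hηξ : η ≠ ξ) {H : H1 → ℝ} (hH2 : ContDiffAt ℝ 2 H η)
    (hkohn : kohn H η = 0) {ε : ℝ} (hε : 0 < ε) (Q : ℝ) :
    ¬ IsLocalMin (fun η => Γξ ξ η - H η + ε * (Q - η.1 ^ 2)) η := by
  intro hloc
  have hpos := koranyiQuartic_pos hηξ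
  have hlocl (v : H1) : IsLocalMin (fun s : ℝ => Γξ ξ (η + s • v) - H (η + s • v) +
      ε * (Q - (η + s • v).1 ^ 2)) 0 := by
    have hline : Tendsto (fun s : ℝ => η + s • v) (𝓝 0) (𝓝 η) :=
      Continuous.tendsto' (by fun_prop) _ _ (by simp)
    simpa [IsLocalMin, IsMinFilter] using hline.eventually hloc
  obtain ⟨x, y, t⟩ := η
  obtain ⟨x₀, y₀, t₀⟩ := ξ
  obtain ⟨a, ha⟩ : ∃ a, a = x - x₀ := ⟨_, rfl⟩
  obtain ⟨b, hb⟩ : ∃ b, b = y - y₀ := ⟨_, rfl⟩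
  obtain ⟨c, hc⟩ : ∃ c, c = t - t₀ + 2 * (x₀ * y - x * y₀) := ⟨_, rfl⟩
  have hr : koranyiQuartic (x₀, y₀, t₀) (x, y, t) = (a ^ 2 + b ^ 2) ^ 2 + c ^ 2 := by
    rw [ha, hb, hc, koranyiQuartic]
  rw [hr] at hpos
  have hqX (s : ℝ) : HasDerivAt (fun s => ε * (Q - (x + s) ^ 2)) (ε * (-(2 * (x + s)))) s := by
    simpa using (((((hasDerivAt_id s).const_add x).pow 2).const_sub Q).const_mul ε)
  have hqX' : HasDerivAt (fun s => ε * (-(2 * (x + s)))) (ε * (-2)) 0 := by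
    simpa using (((((hasDerivAt_id (0 : ℝ)).const_add x).const_mul 2).neg).const_mul ε)
  have hX := second_order_along_horizontal_line hpos (hlocl (1, 0, 2 * y))
    (h := fun s => H ((x, y, t) + s • (1, 0, 2 * y))) (h'' := Xd (Xd H) (x, y, t))
    (p := fun s => ε * (Q - (x + s) ^ 2))
    (fun s => by
      have e : koranyiQuartic (x₀, y₀, t₀) ((x, y, t) + s • (1, 0, 2 * y)) =
          ((a + s) ^ 2 + b ^ 2) ^ 2 + (c + 2 * b * s) ^ 2 := by
        simp [koranyiQuartic, ha, hb, hc]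
        ring
      rw [Γξ_eq_rpow, e]
      simp)
    (eventually_hasDerivAt_line hH2 (1, 0, 2 * y))
    (hasDerivAt_fderiv_line hH2 (V := fun η => (1, 0, 2 * η.2.1)) (by fun_prop) (by simp))
    hqX hqX'
  have hY := second_order_along_horizontal_line (a := b) (b := -a) (c := c)
    (by convert hpos using 2; ring) (hlocl (0, 1, -2 * x))
    (h := fun s => H ((x, y, t) + s • (0, 1, -2 * x))) (h'' := Yd (Yd H) (x, y, t))
    (p := fun _ => ε * (Q - x ^ 2)) (p' := fun _ => 0)
    (fun s => by
      have e : koranyiQuartic (x₀, y₀, t₀) ((x, y, t) + s • (0, 1, -2 * x)) =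
          ((b + s) ^ 2 + (-a) ^ 2) ^ 2 + (c + 2 * (-a) * s) ^ 2 := by
        simp [koranyiQuartic, ha, hb, hc]
        ring
      rw [Γξ_eq_rpow, e]
      simp)
    (eventually_hasDerivAt_line hH2 (0, 1, -2 * x))
    (hasDerivAt_fderiv_line hH2 (V := fun η => (0, 1, -2 * η.1)) (by fun_prop) (by simp))
    (fun s => hasDerivAt_const s _) (hasDerivAt_const _ _)
  have hYX : (b ^ 2 + (-a) ^ 2) ^ 2 + c ^ 2 = (a ^ 2 + b ^ 2) ^ 2 + c ^ 2 := by ring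
  rw [hYX] at hY
  rw [kohn] at hkohn
  generalize ((a ^ 2 + b ^ 2) ^ 2 + c ^ 2) ^ (-5 / 2 : ℝ) = R at hX hY
  have : 2 * ε ≤ 0 := by linear_combination hX + hY - hkohn
  linarith

/-- The Green's function G_ξ = Γ_ξ − H is nonnegative on Ω ∖ {ξ}. -/
theorem green_nonneg (Ω : Set H1) (hΩo : IsOpen Ω) (hΩb : Bornology.IsBounded Ω)
    (ξ : H1) (hξ : ξ ∈ Ω) (H : H1 → ℝ)
    (hHc : ContinuousOn H (closure Ω)) (hHd : ContDiffOn ℝ 2 H Ω)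
    (hHh : ∀ η ∈ Ω, kohn H η = 0)
    (hHb : ∀ η ∈ frontier Ω, H η = Γξ ξ η) :
    ∀ η ∈ Ω \ {ξ}, 0 ≤ Γξ ξ η - H η := by
  rintro η₀ ⟨hη₀, hne⟩
  by_contra! hneg
  have hcpt : IsCompact (closure Ω) := hΩb.isCompact_closure
  obtain ⟨M, hM⟩ := hcpt.bddAbove_image hHc
  obtain ⟨Q, hQ⟩ := hcpt.bddAbove_image
    (f := fun η : H1 => η.1 ^ 2) (by fun_prop)
  replace hM : ∀ η ∈ closure Ω, H η ≤ M := fun η hη => hM ⟨η, hη, rfl⟩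
  replace hQ : ∀ η ∈ closure Ω, η.1 ^ 2 ≤ Q := fun η hη => hQ ⟨η, hη, rfl⟩
  obtain ⟨ε, hε, hεη₀⟩ : ∃ ε > 0, Γξ ξ η₀ - H η₀ + ε * (Q - η₀.1 ^ 2) < 0 := by
    have ht : Tendsto (fun ε : ℝ => Γξ ξ η₀ - H η₀ + ε * (Q - η₀.1 ^ 2)) (𝓝[>] 0)
        (𝓝 (Γξ ξ η₀ - H η₀)) :=
      (Continuous.tendsto' (by fun_prop) _ _ (by simp)).mono_left nhdsWithin_le_nhds
    obtain ⟨ε, h₁, h₂⟩ := ((ht.eventually (gt_mem_nhds hneg)).and self_mem_nhdsWithin).exists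
    exact ⟨ε, h₂, h₁⟩
  set F : H1 → ℝ := fun η => Γξ ξ η - H η + ε * (Q - η.1 ^ 2) with hF
  obtain ⟨δ, hδ, hδF⟩ : ∃ δ > 0, ∀ η ∈ closure Ω, η ≠ ξ → koranyiQuartic ξ η < δ → 0 ≤ F η := by
    have ht : Tendsto (fun r : ℝ => 1 / (8 * π) * r ^ (-1 / 2 : ℝ)) (𝓝[>] 0) atTop :=
      (tendsto_rpow_neg_nhdsGT_zero (by norm_num)).const_mul_atTop (by positivity)
    obtain ⟨δ, hδ, h⟩ := mem_nhdsGT_iff_exists_Ioo_subset.1 (ht.eventually_ge_atTop M)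
    refine ⟨δ, hδ, fun η hη hηξ hlt => ?_⟩
    have h₁ : M ≤ Γξ ξ η := by
      rw [Γξ_eq_rpow]
      exact h ⟨koranyiQuartic_pos hηξ, hlt⟩
    have h₂ : 0 ≤ ε * (Q - η.1 ^ 2) := mul_nonneg hε.le (sub_nonneg.2 (hQ η hη))
    simp only [hF]
    linarith [hM η hη]
  set K := closure Ω ∩ {η | δ ≤ koranyiQuartic ξ η} with hK
  have hKcpt : IsCompact K :=
    hcpt.inter_right (isClosed_le continuous_const (continuous_koranyiQuartic ξ))
  have hη₀K : η₀ ∈ K := by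
    refine ⟨subset_closure hη₀, ?_⟩
    by_contra hlt
    exact absurd (hδF η₀ (subset_closure hη₀) hne (not_le.1 hlt)) (not_le.2 hεη₀)
  have hFc : ContinuousOn F K := by
    have hΓ : ContinuousOn (Γξ ξ) K := by
      simp only [funext (Γξ_eq_rpow ξ)]
      exact continuousOn_const.mul ((continuous_koranyiQuartic ξ).continuousOn.rpow_const
        fun η hη => Or.inl (hδ.trans_le hη.2).ne')
    exact (hΓ.sub (hHc.mono inter_subset_left)).add (by fun_prop)
  obtain ⟨η, hηK, hmin⟩ := hKcpt.exists_isMinOn ⟨η₀, hη₀K⟩ hFc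
  have hFη : F η < 0 := (hmin hη₀K).trans_lt hεη₀
  have hpos : 0 < koranyiQuartic ξ η := hδ.trans_le hηK.2
  have hηΩ : η ∈ Ω := by
    by_contra hn
    have hfr : η ∈ frontier Ω := by
      rw [hΩo.frontier_eq]
      exact ⟨hηK.1, hn⟩
    have h₂ : 0 ≤ ε * (Q - η.1 ^ 2) := mul_nonneg hε.le (sub_nonneg.2 (hQ η hηK.1))
    simp only [hF, hHb η hfr] at hFη
    linarith
  have hηξ : η ≠ ξ := by
    rintro rfl
    simp [koranyiQuartic] at hpos
  have hloc : IsLocalMin F η := by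
    filter_upwards [hΩo.mem_nhds hηΩ, isOpen_ne.mem_nhds hηξ] with ζ hζ hζξ
    by_cases h : δ ≤ koranyiQuartic ξ ζ
    · exact hmin ⟨subset_closure hζ, h⟩
    · exact hFη.le.trans (hδF ζ (subset_closure hζ) hζξ (not_le.1 h))
  exact not_isLocalMin_barrier hηξ (hHd.contDiffAt (hΩo.mem_nhds hηΩ)) (hHh η hηΩ) hε Q hloc
end
end

section
/- Let Ω ⊆ ℝ³ be a bounded open set, ξ ∈ Ω, and let H be a regular part of the Green's function of Ω at ξ (H continuous on the closure of Ω, Δ_ℍ H = 0 on Ω, H = Γ_ξ on ∂Ω) with H(ξ) > 0, and let r_Ω(ξ) = 1/√(8π H(ξ)) be the harmonic radius. Then inf_{η ∈ ∂Ω} d(ξ,η) ≤ r_Ω(ξ) ≤ sup_{η ∈ ∂Ω} d(ξ,η). -/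
open MeasureTheory Real Set

noncomputable section

lemma kd_nonneg (ξ η : H1) : 0 ≤ kd ξ η := by
  unfold kd ρH
  positivity

lemma continuous_kd (ξ : H1) : Continuous (kd ξ) := by
  unfold kd ρH hmul hinv
  refine Continuous.rpow_const (by fun_prop) fun _ => Or.inr (by norm_num)

lemma kd_pos {ξ η : H1} (h : η ≠ ξ) : 0 < kd ξ η := by
  refine (kd_nonneg ξ η).lt_of_ne' fun h0 => h ?_
  obtain ⟨x₀, y₀, t₀⟩ := ξ
  obtain ⟨x, y, t⟩ := η
  simp only [kd, ρH, hmul, hinv] at h0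
  rw [Real.rpow_eq_zero (by positivity) (by norm_num)] at h0
  have h1 : (-x₀ + x) ^ 2 + (-y₀ + y) ^ 2 = 0 := by
    nlinarith [sq_nonneg ((-x₀ + x) ^ 2 + (-y₀ + y) ^ 2),
      sq_nonneg (-t₀ + t + 2 * (x * -y₀ - -x₀ * y))]
  have hx : x = x₀ := by nlinarith [sq_nonneg (-x₀ + x), sq_nonneg (-y₀ + y)]
  have hy : y = y₀ := by nlinarith [sq_nonneg (-x₀ + x), sq_nonneg (-y₀ + y)]
  subst hx hy
  have ht : t = t₀ := by nlinarith
  rw [ht]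

/-- Second-order necessary condition at a local maximum, along a line on which `F` is the
directional derivative of `w`. -/
lemma fderiv_apply_nonpos_of_isLocalMax {w F : H1 → ℝ} {p v : H1}
    (hw : ∀ᶠ q in nhds p, DifferentiableAt ℝ w q)
    (hF : ∀ s : ℝ, F (p + s • v) = fderiv ℝ w (p + s • v) v)
    (hFd : DifferentiableAt ℝ F p) (hmax : IsLocalMax w p) : fderiv ℝ F p v ≤ 0 := by
  have hline : ∀ s : ℝ, HasDerivAt (fun s : ℝ => p + s • v) v s := fun s => by
    simpa using ((hasDerivAt_id s).smul_const v).const_add p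
  have hlim : Filter.Tendsto (fun s : ℝ => p + s • v) (nhds 0) (nhds p) := by
    simpa using (hline 0).continuousAt.tendsto
  set g : ℝ → ℝ := fun s => w (p + s • v) with hg
  have hg1 : deriv g =ᶠ[nhds 0] fun s => F (p + s • v) := by
    filter_upwards [hlim.eventually hw] with s hs
    rw [hF]
    exact (hs.hasFDerivAt.comp_hasDerivAt s (hline s)).deriv
  have hg2 : deriv (deriv g) 0 = fderiv ℝ F p v := by
    rw [hg1.deriv_eq]
    have hp : HasFDerivAt F (fderiv ℝ F p) (p + (0 : ℝ) • v) := by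
      simpa using hFd.hasFDerivAt
    exact (hp.comp_hasDerivAt 0 (hline 0)).deriv
  have hgmax : IsLocalMax g 0 := by
    filter_upwards [hlim.eventually hmax] with s hs
    simpa [hg] using hs
  by_contra! hpos
  have hgc : ContinuousAt g 0 := by
    have hp : ContinuousAt w (p + (0 : ℝ) • v) := by
      simpa using hw.self_of_nhds.continuousAt
    exact ContinuousAt.comp (f := fun s : ℝ => p + s • v) hp (hline 0).continuousAt
  have hgmin : IsLocalMin g 0 :=
    isLocalMin_of_deriv_deriv_pos (hg2 ▸ hpos) hgmax.deriv_eq_zero hgc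
  have hconst : g =ᶠ[nhds 0] fun _ => g 0 := by
    filter_upwards [hgmax, hgmin] with s h1 h2 using le_antisymm h1 h2
  have : deriv (deriv g) 0 = 0 := by
    rw [hconst.deriv.deriv_eq]
    simp
  linarith

lemma differentiableAt_fderiv_apply {w : H1 → ℝ} {p : H1} {V : H1 → H1}
    (hw : ContDiffAt ℝ 2 w p) (hV : DifferentiableAt ℝ V p) :
    DifferentiableAt ℝ (fun q => fderiv ℝ w q (V q)) p :=
  ((hw.fderiv_right (m := 1) (by norm_num)).differentiableAt one_ne_zero).clm_apply hV

lemma differentiableAt_Xd {w : H1 → ℝ} {p : H1} (hw : ContDiffAt ℝ 2 w p) :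
    DifferentiableAt ℝ (Xd w) p :=
  differentiableAt_fderiv_apply (V := fun q => (1, 0, 2 * q.2.1)) hw (by fun_prop)

lemma differentiableAt_Yd {w : H1 → ℝ} {p : H1} (hw : ContDiffAt ℝ 2 w p) :
    DifferentiableAt ℝ (Yd w) p :=
  differentiableAt_fderiv_apply (V := fun q => (0, 1, -2 * q.1)) hw (by fun_prop)

lemma ContDiffAt.eventually_differentiableAt_of_two {w : H1 → ℝ} {p : H1}
    (hw : ContDiffAt ℝ 2 w p) : ∀ᶠ q in nhds p, DifferentiableAt ℝ w q := by
  filter_upwards [hw.eventually (by simp)] with q hq using hq.differentiableAt two_ne_zero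

lemma kohn_nonpos_of_isLocalMax {w : H1 → ℝ} {p : H1} (hw : ContDiffAt ℝ 2 w p)
    (hmax : IsLocalMax w p) : kohn w p ≤ 0 := by
  have hd := hw.eventually_differentiableAt_of_two
  refine add_nonpos
    (fderiv_apply_nonpos_of_isLocalMax hd (fun s => ?_) (differentiableAt_Xd hw) hmax)
    (fderiv_apply_nonpos_of_isLocalMax hd (fun s => ?_) (differentiableAt_Yd hw) hmax) <;>
  simp [Xd, Yd]

lemma kohn_add {u v : H1 → ℝ} {p : H1} (hu : ContDiffAt ℝ 2 u p) (hv : ContDiffAt ℝ 2 v p) :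
    kohn (fun q => u q + v q) p = kohn u p + kohn v p := by
  have hd := hu.eventually_differentiableAt_of_two.and hv.eventually_differentiableAt_of_two
  have hX : Xd (fun q => u q + v q) =ᶠ[nhds p] fun q => Xd u q + Xd v q := by
    filter_upwards [hd] with q hq
    simp [Xd, fderiv_fun_add hq.1 hq.2]
  have hY : Yd (fun q => u q + v q) =ᶠ[nhds p] fun q => Yd u q + Yd v q := by
    filter_upwards [hd] with q hq
    simp [Yd, fderiv_fun_add hq.1 hq.2]
  have hXX : Xd (Xd (fun q => u q + v q)) p = Xd (Xd u) p + Xd (Xd v) p := by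
    conv_lhs => rw [Xd, hX.fderiv_eq,
      fderiv_fun_add (differentiableAt_Xd hu) (differentiableAt_Xd hv)]
    rfl
  have hYY : Yd (Yd (fun q => u q + v q)) p = Yd (Yd u) p + Yd (Yd v) p := by
    conv_lhs => rw [Yd, hY.fderiv_eq,
      fderiv_fun_add (differentiableAt_Yd hu) (differentiableAt_Yd hv)]
    rfl
  rw [kohn, hXX, hYY, kohn, kohn]
  ring

lemma kohn_neg (u : H1 → ℝ) (p : H1) : kohn (fun q => -u q) p = -kohn u p := by
  have hX : ∀ f : H1 → ℝ, Xd (fun q => -f q) = fun q => -Xd f q := fun f => by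
    ext q; simp [Xd, fderiv_fun_neg]
  have hY : ∀ f : H1 → ℝ, Yd (fun q => -f q) = fun q => -Yd f q := fun f => by
    ext q; simp [Yd, fderiv_fun_neg]
  simp only [kohn, hX, hY]
  ring

lemma kohn_const_mul_fst_sq (ε : ℝ) (p : H1) : kohn (fun q => ε * q.1 ^ 2) p = 2 * ε := by
  have hf : ∀ q : H1, HasFDerivAt (fun q : H1 => ε * q.1 ^ 2)
      ((2 * ε * q.1) • ContinuousLinearMap.fst ℝ ℝ (ℝ × ℝ)) q := fun q => by
    refine (((hasFDerivAt_fst (𝕜 := ℝ) (p := q)).pow 2).const_mul ε).congr_fderiv ?_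
    rw [smul_smul]
    congr 1
    simp
    ring
  have hX : Xd (fun q => ε * q.1 ^ 2) = fun q => (2 * ε) * q.1 := by
    ext q; simp [Xd, (hf q).fderiv]
  have hY : Yd (fun q => ε * q.1 ^ 2) = fun _ => 0 := by
    ext q; simp [Yd, (hf q).fderiv]
  have hXX : HasFDerivAt (fun q : H1 => (2 * ε) * q.1)
      ((2 * ε) • ContinuousLinearMap.fst ℝ ℝ (ℝ × ℝ)) p := hasFDerivAt_fst.const_mul (2 * ε)
  rw [kohn, hX, hY, Xd, Yd, hXX.fderiv]
  simp

/-- Weak maximum principle for the Kohn-Laplacian. -/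
lemma le_of_kohn_eq_zero {Ω : Set H1} (hΩo : IsOpen Ω) (hΩb : Bornology.IsBounded Ω)
    {u : H1 → ℝ} (huc : ContinuousOn u (closure Ω)) (hud : ContDiffOn ℝ 2 u Ω)
    (hu : ∀ η ∈ Ω, kohn u η = 0) {c : ℝ} (hc : ∀ η ∈ frontier Ω, u η ≤ c)
    {ξ : H1} (hξ : ξ ∈ Ω) : u ξ ≤ c := by
  have hK : IsCompact (closure Ω) := hΩb.isCompact_closure
  obtain ⟨C, hC⟩ := hK.bddAbove_image (f := fun q : H1 => q.1 ^ 2) (by fun_prop)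
  have hC' : ∀ q ∈ closure Ω, q.1 ^ 2 ≤ C := fun q hq => hC (mem_image_of_mem _ hq)
  have key : ∀ ε > 0, u ξ ≤ c + ε * C := by
    intro ε hε
    set w : H1 → ℝ := fun q => u q + ε * q.1 ^ 2 with hw
    obtain ⟨p, hp, hpmax⟩ := hK.exists_isMaxOn ⟨ξ, subset_closure hξ⟩
      (f := w) (huc.add (by fun_prop))
    have hpΩ : p ∉ Ω := by
      intro hpΩ
      have hup : ContDiffAt ℝ 2 u p := hud.contDiffAt (hΩo.mem_nhds hpΩ)
      have hvp : ContDiffAt ℝ 2 (fun q : H1 => ε * q.1 ^ 2) p := by fun_prop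
      have h1 := kohn_nonpos_of_isLocalMax (hup.add hvp)
        (hpmax.isLocalMax (Filter.mem_of_superset (hΩo.mem_nhds hpΩ) subset_closure))
      have h2 := kohn_add hup hvp
      rw [hu p hpΩ, kohn_const_mul_fst_sq] at h2
      have h3 : kohn (fun q => u q + ε * q.1 ^ 2) p ≤ 0 := h1
      linarith
    have hpf : p ∈ frontier Ω := by
      rw [hΩo.frontier_eq]
      exact ⟨hp, hpΩ⟩
    have h1 : u ξ + ε * ξ.1 ^ 2 ≤ u p + ε * p.1 ^ 2 := hpmax (subset_closure hξ)
    have h2 := mul_le_mul_of_nonneg_left (hC' p hp) hε.le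
    have h3 : 0 ≤ ε * ξ.1 ^ 2 := by positivity
    linarith [hc p hpf]
  have hC0 : 0 ≤ C := (sq_nonneg ξ.1).trans (hC' ξ (subset_closure hξ))
  refine le_of_forall_pos_le_add fun δ hδ => (key (δ / (C + 1)) (by positivity)).trans ?_
  have : δ / (C + 1) * C ≤ δ := by
    rw [div_mul_eq_mul_div, div_le_iff₀ (by positivity)]
    nlinarith
  linarith

/-- The harmonic radius r_Ω(ξ) = 1/√(8π H(ξ)) satisfies
inf_{η ∈ ∂Ω} d(ξ,η) ≤ r_Ω(ξ) ≤ sup_{η ∈ ∂Ω} d(ξ,η). -/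
theorem harmonic_radius_bounds (Ω : Set H1) (hΩo : IsOpen Ω) (hΩb : Bornology.IsBounded Ω)
    (ξ : H1) (hξ : ξ ∈ Ω) (H : H1 → ℝ)
    (hHc : ContinuousOn H (closure Ω)) (hHd : ContDiffOn ℝ 2 H Ω)
    (hHh : ∀ η ∈ Ω, kohn H η = 0)
    (hHb : ∀ η ∈ frontier Ω, H η = Γξ ξ η)
    (hHξ : 0 < H ξ) :
    sInf (kd ξ '' frontier Ω) ≤ 1 / Real.sqrt (8 * π * H ξ) ∧
    1 / Real.sqrt (8 * π * H ξ) ≤ sSup (kd ξ '' frontier Ω) := by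
  have hcpt : IsCompact (frontier Ω) :=
    hΩb.isCompact_closure.of_isClosed_subset isClosed_frontier frontier_subset_closure
  have hne : (frontier Ω).Nonempty := by
    by_contra hempty
    rw [not_nonempty_iff_eq_empty] at hempty
    have := le_of_kohn_eq_zero hΩo hΩb hHc hHd hHh (c := H ξ - 1) (by simp [hempty]) hξ
    linarith
  have hHf : ContinuousOn H (frontier Ω) := hHc.mono frontier_subset_closure
  obtain ⟨p, hp, hpmax⟩ := hcpt.exists_isMaxOn hne hHf
  obtain ⟨q, hq, hqmin⟩ := hcpt.exists_isMinOn hne hHf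
  have hHp : H ξ ≤ Γξ ξ p := by
    rw [← hHb p hp]
    exact le_of_kohn_eq_zero hΩo hΩb hHc hHd hHh (fun η hη => hpmax hη) hξ
  have hHq : Γξ ξ q ≤ H ξ := by
    rw [← hHb q hq]
    refine neg_le_neg_iff.1 (le_of_kohn_eq_zero (u := fun η => -H η) hΩo hΩb hHc.neg hHd.neg
      (fun η hη => ?_) (fun η hη => neg_le_neg (hqmin hη)) hξ)
    rw [kohn_neg, hHh η hη, neg_zero]
  have hpos : ∀ η ∈ frontier Ω, 0 < kd ξ η := fun η hη => kd_pos fun h => by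
    rw [hΩo.frontier_eq, h] at hη
    exact hη.2 hξ
  have hdp := hpos p hp
  have hdq := hpos q hq
  have hπ : 0 < 8 * π := by positivity
  have hs : 0 < √(8 * π * H ξ) := Real.sqrt_pos.2 (by positivity)
  have hsq : √(8 * π * H ξ) ^ 2 = 8 * π * H ξ := Real.sq_sqrt (by positivity)
  unfold Γξ at hHp hHq
  constructor
  · refine (csInf_le ⟨0, ?_⟩ (mem_image_of_mem _ hp)).trans ?_
    · rintro _ ⟨η, -, rfl⟩
      exact kd_nonneg ξ η
    · rw [le_div_iff₀ (by positivity)] at hHp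
      rw [le_div_iff₀ hs]
      refine (sq_le_one_iff₀ (by positivity)).1 ?_
      rw [mul_pow, hsq]
      linarith
  · refine le_trans ?_ (le_csSup (hcpt.bddAbove_image (continuous_kd ξ).continuousOn)
      (mem_image_of_mem _ hq))
    rw [div_le_iff₀ (by positivity)] at hHq
    rw [div_le_iff₀ hs]
    refine (one_le_sq_iff₀ (by positivity)).1 ?_
    rw [mul_pow, hsq]
    linarith
end
end

section
/- Let Ω ⊆ ℝ³ be a bounded open set, ξ ∈ Ω, H a regular part of the Green's function of Ω at ξ (H continuous on the closure of Ω, Δ_ℍ H = 0 on Ω, H = Γ_ξ on ∂Ω) with H(ξ) > 0, G_ξ = Γ_ξ − H, and r_Ω(ξ) = 1/√(8π H(ξ)). For τ > 0 let Ω(τ) = {ξ} ∪ {η ∈ Ω ∖ {ξ} : G_ξ(η) > τ}. Then: (i) H + τ is Kohn-harmonic on Ω(τ) and equals Γ_ξ on ∂Ω(τ) (so G_ξ − τ is the Green's function of Ω(τ) at ξ with regular part H + τ); (ii) the harmonic radius of Ω(τ) at ξ, r_{Ω(τ)}(ξ) = 1/√(8π (H(ξ)+τ)), satisfies r_{Ω(τ)}(ξ)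 = r_Ω(ξ)/√(8π τ r_Ω(ξ)² + 1). -/
open MeasureTheory Real Set

noncomputable section

lemma ρH_base_nonneg (η : H1) : 0 ≤ (η.1 ^ 2 + η.2.1 ^ 2) ^ 2 + η.2.2 ^ 2 := by positivity

lemma continuous_ρH : Continuous ρH := by
  unfold ρH
  exact Continuous.rpow_const (by fun_prop) fun _ => Or.inr (by norm_num)

lemma ρH_eq_zero_iff {η : H1} : ρH η = 0 ↔ η = 0 := by
  unfold ρH
  rw [Real.rpow_eq_zero (ρH_base_nonneg η) (by norm_num)]
  refine ⟨fun h => ?_, ?_⟩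
  · have ht : η.2.2 = 0 := by nlinarith [sq_nonneg (η.1 ^ 2 + η.2.1 ^ 2), sq_nonneg η.2.2]
    have hxy : η.1 ^ 2 + η.2.1 ^ 2 = 0 := by
      rw [ht] at h
      simpa using h
    have hx : η.1 = 0 := by nlinarith [sq_nonneg η.1, sq_nonneg η.2.1]
    have hy : η.2.1 = 0 := by nlinarith [sq_nonneg η.1, sq_nonneg η.2.1]
    exact Prod.ext hx (Prod.ext hy ht)
  · rintro rfl
    simp

lemma kd_eq_zero_iff {ξ η : H1} : kd ξ η = 0 ↔ η = ξ := by
  unfold kd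
  rw [ρH_eq_zero_iff]
  obtain ⟨x, y, t⟩ := η
  obtain ⟨a, b, c⟩ := ξ
  simp only [hmul, hinv, Prod.mk_eq_zero, Prod.mk.injEq]
  constructor
  · rintro ⟨h1, h2, h3⟩
    obtain rfl : x = a := by linarith
    obtain rfl : y = b := by linarith
    exact ⟨rfl, rfl, by linarith⟩
  · rintro ⟨rfl, rfl, rfl⟩
    exact ⟨by ring, by ring, by ring⟩

lemma continuousAt_Γξ {ξ η : H1} (h : η ≠ ξ) : ContinuousAt (Γξ ξ) η := by
  have hk : kd ξ η ≠ 0 := fun h0 => h (kd_eq_zero_iff.1 h0)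
  have hc := (continuous_kd ξ).continuousAt (x := η)
  exact continuousAt_const.div (continuousAt_const.mul (hc.pow 2)) (by positivity)

/-- The fundamental solution tends to infinity at its pole, with the pole itself removed. -/
lemma tendsto_Γξ_atTop (ξ : H1) : Filter.Tendsto (Γξ ξ) (nhdsWithin ξ {ξ}ᶜ) Filter.atTop := by
  have hc : Continuous fun η => 8 * π * kd ξ η ^ 2 :=
    continuous_const.mul ((continuous_kd ξ).pow 2)
  have h0 : Filter.Tendsto (fun η => 8 * π * kd ξ η ^ 2) (nhdsWithin ξ {ξ}ᶜ)
      (nhdsWithin 0 (Set.Ioi 0)) := by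
    refine tendsto_nhdsWithin_iff.2 ⟨?_, ?_⟩
    · have := hc.tendsto ξ
      rw [kd_eq_zero_iff.2 rfl] at this
      simpa using this.mono_left nhdsWithin_le_nhds
    · filter_upwards [self_mem_nhdsWithin] with η hη
      have hk : kd ξ η ≠ 0 := fun h0 => hη (kd_eq_zero_iff.1 h0)
      have : 0 < 8 * π * kd ξ η ^ 2 := by positivity
      exact this
  have h1 := h0.inv_tendsto_nhdsGT_zero
  refine h1.congr fun η => ?_
  simp [Γξ]

lemma kohn_add_const (u : H1 → ℝ) (c : ℝ) : kohn (fun ζ => u ζ + c) = kohn u := by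
  have hX : Xd (fun ζ => u ζ + c) = Xd u := by
    funext η
    simp [Xd]
  have hY : Yd (fun ζ => u ζ + c) = Yd u := by
    funext η
    simp [Yd]
  funext η
  simp only [kohn, hX, hY]

lemma inv_sqrt_add_eq {h : ℝ} (hh : 0 < h) (τ : ℝ) :
    1 / √(8 * π * (h + τ)) =
      (1 / √(8 * π * h)) / √(8 * π * τ * (1 / √(8 * π * h)) ^ 2 + 1) := by
  have hp : 0 < 8 * π * h := by positivity
  rw [div_div, ← Real.sqrt_mul hp.le, div_pow, Real.sq_sqrt hp.le]
  congr 2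
  field_simp
  ring

/-- Superlevel sets of a function blowing up at `ξ` are neighbourhoods of `ξ` once `ξ` is added. -/
lemma superlevel_mem_nhds {Ω : Set H1} (hΩ : IsOpen Ω) {ξ : H1} (hξ : ξ ∈ Ω) {H : H1 → ℝ}
    (hH : ContinuousAt H ξ) (τ : ℝ) :
    {ξ} ∪ {η ∈ Ω \ {ξ} | Γξ ξ η - H η > τ} ∈ nhds ξ := by
  have hbd : ∀ᶠ η in nhds ξ, H η < H ξ + 1 := hH.eventually_lt_const (by linarith)
  have hbig := (tendsto_Γξ_atTop ξ).eventually_gt_atTop (H ξ + 1 + τ)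
  rw [eventually_nhdsWithin_iff] at hbig
  filter_upwards [hbd, hbig, hΩ.mem_nhds hξ] with η h1 h2 h3
  by_cases hη : η = ξ
  · exact Or.inl hη
  · have := h2 hη
    exact Or.inr ⟨⟨h3, hη⟩, by linarith⟩

/-- On the boundary of a positive superlevel set, `Γξ ξ - H` attains the level. -/
lemma eq_level_of_mem_frontier {Ω : Set H1} (hΩ : IsOpen Ω) {ξ : H1} (hξ : ξ ∈ Ω) {H : H1 → ℝ}
    (hHc : ContinuousOn H (closure Ω)) (hHb : ∀ η ∈ frontier Ω, H η = Γξ ξ η)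
    {τ : ℝ} (hτ : 0 < τ) {η : H1}
    (hη : η ∈ frontier ({ξ} ∪ {η ∈ Ω \ {ξ} | Γξ ξ η - H η > τ})) :
    Γξ ξ η - H η = τ := by
  have hat : ∀ ζ ∈ Ω, ContinuousAt H ζ := fun ζ hζ =>
    hHc.continuousAt (Filter.mem_of_superset (hΩ.mem_nhds hζ) subset_closure)
  have hnhds := superlevel_mem_nhds hΩ hξ (hat ξ hξ) τ
  set A : Set H1 := {ξ} ∪ {η ∈ Ω \ {ξ} | Γξ ξ η - H η > τ}
  have hAΩ : A ⊆ Ω := by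
    rintro ζ (rfl | hζ)
    · exact hξ
    · exact hζ.1.1
  have hne : η ≠ ξ := by
    rintro rfl
    exact hη.2 (mem_interior_iff_mem_nhds.2 hnhds)
  have hcl : η ∈ closure Ω := closure_mono hAΩ hη.1
  have hge : τ ≤ Γξ ξ η - H η := by
    have : (nhdsWithin η A).NeBot := mem_closure_iff_nhdsWithin_neBot.1 hη.1
    have hlim : Filter.Tendsto (fun ζ => Γξ ξ ζ - H ζ) (nhdsWithin η A)
        (nhds (Γξ ξ η - H η)) :=
      (continuousAt_Γξ hne).continuousWithinAt.sub
        ((hHc η hcl).mono (hAΩ.trans subset_closure))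
    refine ge_of_tendsto hlim ?_
    filter_upwards [self_mem_nhdsWithin, nhdsWithin_le_nhds (isOpen_ne.mem_nhds hne)] with ζ h1 h2
    rcases h1 with h1 | h1
    · exact absurd h1 h2
    · exact h1.2.le
  by_cases hηΩ : η ∈ Ω
  · refine le_antisymm (not_lt.1 fun hlt => hη.2 (mem_interior_iff_mem_nhds.2 ?_)) hge
    have hev := ((continuousAt_Γξ hne).sub (hat η hηΩ)).eventually_const_lt hlt
    filter_upwards [hev, isOpen_ne.mem_nhds hne, hΩ.mem_nhds hηΩ] with ζ h1 h2 h3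
    exact Or.inr ⟨⟨h3, h2⟩, h1⟩
  · have := hHb η ⟨hcl, fun h => hηΩ (interior_subset h)⟩
    linarith

/-- For the level set Ω(τ) = {ξ} ∪ {η ∈ Ω ∖ {ξ} : G_ξ(η) > τ}:
(i) H + τ is Kohn-harmonic on Ω(τ) and equals Γ_ξ on ∂Ω(τ);
(ii) r_{Ω(τ)}(ξ) = 1/√(8π(H(ξ)+τ)) = r_Ω(ξ)/√(8πτ r_Ω(ξ)² + 1). -/
theorem level_set_harmonic_radius (Ω : Set H1) (hΩo : IsOpen Ω)
    (hΩb : Bornology.IsBounded Ω)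
    (ξ : H1) (hξ : ξ ∈ Ω) (H : H1 → ℝ)
    (hHc : ContinuousOn H (closure Ω)) (hHd : ContDiffOn ℝ 2 H Ω)
    (hHh : ∀ η ∈ Ω, kohn H η = 0)
    (hHb : ∀ η ∈ frontier Ω, H η = Γξ ξ η)
    (hHξ : 0 < H ξ) (τ : ℝ) (hτ : 0 < τ) :
    let G : H1 → ℝ := fun η => Γξ ξ η - H η
    let Ωτ : Set H1 := {ξ} ∪ {η ∈ Ω \ {ξ} | G η > τ}
    (∀ η ∈ Ωτ, kohn (fun ζ => H ζ + τ) η = 0) ∧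
    (∀ η ∈ frontier Ωτ, H η + τ = Γξ ξ η) ∧
    1 / Real.sqrt (8 * π * (H ξ + τ)) =
      (1 / Real.sqrt (8 * π * H ξ)) /
        Real.sqrt (8 * π * τ * (1 / Real.sqrt (8 * π * H ξ)) ^ 2 + 1) := by
  intro G Ωτ
  refine ⟨fun η hη => ?_, fun η hη => ?_, inv_sqrt_add_eq hHξ τ⟩
  · rw [kohn_add_const]
    rcases hη with rfl | hη
    · exact hHh _ hξ
    · exact hHh η hη.1.1
  · have := eq_level_of_mem_frontier hΩo hξ hHc hHb hτ hη
    linarith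
end
end

section
/- Let Ω ⊆ ℝ³ be a bounded open set with smooth boundary such that Ω and ℍ¹ ∖ closure(Ω) satisfy the uniform exterior ball property, let ξ ∈ Ω, and let H be a regular part of the Green's function of Ω at ξ with H(ξ) > 0 and harmonic radius r_Ω(ξ) = 1/√(8π H(ξ)). Then |B(ξ, r_Ω(ξ))| ≤ α_Ω(ξ)⁴ · |Ω|, where α_Ω(ξ) = (sup_{η∈∂Ω} d(ξ,η))/(inf_{η∈∂Ω} d(ξ,η)). -/
open MeasureTheory Real Set

noncomputable section

/-- The second derivative of a real function at a local minimum is nonnegative. -/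
lemma IsLocalMin.deriv_deriv_nonneg {g : ℝ → ℝ} {a : ℝ} (h : IsLocalMin g a)
    (hc : ContinuousAt g a) : 0 ≤ deriv (deriv g) a := by
  by_contra! hneg
  have hmax : IsLocalMax g a :=
    isLocalMax_of_deriv_deriv_neg hneg h.deriv_eq_zero hc
  have hconst : g =ᶠ[nhds a] fun _ => g a := by
    filter_upwards [h, hmax] with x hx hx'
    exact le_antisymm hx' hx
  have : deriv (deriv g) a = 0 := by
    rw [hconst.deriv.deriv_eq]
    simp
  linarith

/-- The velocity at `s = 0` of a function along the line through `p` with direction `w`. -/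
lemma DifferentiableAt.hasDerivAt_line {u : H1 → ℝ} {p w : H1} {s : ℝ}
    (h : DifferentiableAt ℝ u (p + s • w)) :
    HasDerivAt (fun s : ℝ => u (p + s • w)) (fderiv ℝ u (p + s • w) w) s := by
  have hl : HasDerivAt (fun s : ℝ => p + s • w) w s := by
    simpa using ((hasDerivAt_id s).smul_const w).const_add p
  exact h.hasFDerivAt.comp_hasDerivAt s hl

/-- If `Z` is the directional derivative along `W` and `W` is constant along its integral line
through `p`, then a local minimum at `p` of `u - q`, with `q` of second derivative `b` on that
line, forces `Z (Z u) ≥ b`. -/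
lemma second_deriv_line_ge {u q : H1 → ℝ} {W : H1 → H1} {p : H1} {b : ℝ}
    (hu : ContDiffAt ℝ 2 u p) (hW : Differentiable ℝ W) (hWl : ∀ s : ℝ, W (p + s • W p) = W p)
    {q' : ℝ → ℝ} (hq : ∀ s : ℝ, HasDerivAt (fun s : ℝ => q (p + s • W p)) (q' s) s)
    (hq' : HasDerivAt q' b 0) (hmin : IsLocalMin (fun η => u η - q η) p) :
    b ≤ fderiv ℝ (fun η => fderiv ℝ u η (W η)) p (W p) := by
  set w := W p with hw
  set g : ℝ → ℝ := fun s => u (p + s • w) - q (p + s • w) with hg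
  have hline : Continuous fun s : ℝ => p + s • w := by fun_prop
  have hl0 : Filter.Tendsto (fun s : ℝ => p + s • w) (nhds 0) (nhds p) := by
    simpa using hline.tendsto 0
  have hev : ∀ᶠ s : ℝ in nhds 0, DifferentiableAt ℝ u (p + s • w) := by
    refine hl0.eventually ?_
    filter_upwards [hu.eventually (by simp)] with x hx
    exact hx.differentiableAt (by norm_num)
  have hderiv : ∀ᶠ s : ℝ in nhds 0, HasDerivAt g
      (fderiv ℝ u (p + s • w) (W (p + s • w)) - q' s) s := by
    filter_upwards [hev] with s hs
    rw [hWl s]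
    exact hs.hasDerivAt_line.sub (hq s)
  have hd : DifferentiableAt ℝ (fun η => fderiv ℝ u η (W η)) p := by
    have h1 : DifferentiableAt ℝ (fderiv ℝ u) p :=
      (hu.fderiv_right (m := 1) (by norm_num)).differentiableAt (by norm_num)
    exact h1.clm_apply (hW p)
  have hdd : HasDerivAt (fun s : ℝ => fderiv ℝ u (p + s • w) (W (p + s • w)) - q' s)
      (fderiv ℝ (fun η => fderiv ℝ u η (W η)) p w - b) 0 := by
    have := DifferentiableAt.hasDerivAt_line (u := fun η => fderiv ℝ u η (W η)) (p := p) (w := w)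
      (s := 0) (by simpa using hd)
    simp only [zero_smul, add_zero] at this
    exact this.sub hq'
  have hgmin : IsLocalMin g 0 := by
    have := hl0.eventually hmin
    filter_upwards [this] with s hs
    simpa [hg] using hs
  have hgg : deriv (deriv g) 0 = fderiv ℝ (fun η => fderiv ℝ u η (W η)) p w - b := by
    rw [Filter.EventuallyEq.deriv_eq (hderiv.mono fun s hs => hs.deriv)]
    exact hdd.deriv
  have := hgmin.deriv_deriv_nonneg hderiv.self_of_nhds.continuousAt
  linarith

/-- Weak minimum principle for the Kohn-Laplacian. -/
lemma kohn_min_principle {Ω : Set H1} (hΩo : IsOpen Ω) (hΩb : Bornology.IsBounded Ω)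
    {H : H1 → ℝ} (hHc : ContinuousOn H (closure Ω)) (hHd : ContDiffOn ℝ 2 H Ω)
    (hHh : ∀ η ∈ Ω, kohn H η ≤ 0) {c : ℝ} (hc : ∀ η ∈ frontier Ω, c ≤ H η)
    {ξ : H1} (hξ : ξ ∈ Ω) : c ≤ H ξ := by
  by_contra! hlt
  have hK : IsCompact (closure Ω) := hΩb.isCompact_closure
  obtain ⟨K, hKb⟩ := (hK.image (f := fun η : H1 => η.1 ^ 2) (by fun_prop)).bddAbove
  have hKle : ∀ η ∈ closure Ω, η.1 ^ 2 ≤ K := fun η hη => hKb ⟨η, hη, rfl⟩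
  have hK0 : 0 ≤ K := (sq_nonneg _).trans (hKle ξ (subset_closure hξ))
  set ε := (c - H ξ) / (2 * (K + 1)) with hε
  have hε0 : 0 < ε := div_pos (by linarith) (by linarith)
  have hεK : ε * (K + 1) = (c - H ξ) / 2 := by
    rw [hε]; field_simp
  obtain ⟨p, hp, hpmin⟩ := hK.exists_isMinOn ⟨ξ, subset_closure hξ⟩
    (f := fun η => H η - ε * η.1 ^ 2) (hHc.sub (by fun_prop))
  have hpξ : H p - ε * p.1 ^ 2 ≤ H ξ - ε * ξ.1 ^ 2 := hpmin (subset_closure hξ)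
  have hpΩ : p ∈ Ω := by
    by_contra hn
    have h1 := hc p (by rw [hΩo.frontier_eq]; exact ⟨hp, hn⟩)
    have h2 := mul_le_mul_of_nonneg_left (hKle p hp) hε0.le
    have h3 : 0 ≤ ε * ξ.1 ^ 2 := by positivity
    nlinarith
  have hloc : IsLocalMin (fun η : H1 => H η - ε * η.1 ^ 2) p :=
    (hpmin.on_subset subset_closure).isLocalMin (hΩo.mem_nhds hpΩ)
  have hu : ContDiffAt ℝ 2 H p := hHd.contDiffAt (hΩo.mem_nhds hpΩ)
  have hX : 2 * ε ≤ Xd (Xd H) p := by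
    refine second_deriv_line_ge (q' := fun s => 2 * ε * (p.1 + s))
      (W := fun η : H1 => ((1 : ℝ), (0 : ℝ), 2 * η.2.1)) hu (by fun_prop) (by simp) ?_ ?_ hloc
    · intro s
      have := (((hasDerivAt_id' s).const_add p.1).fun_pow 2).const_mul ε
      have h : HasDerivAt (fun s => ε * (p.1 + s) ^ 2) (2 * ε * (p.1 + s)) s :=
        this.congr_deriv (by push_cast; ring)
      simpa only [Prod.fst_add, Prod.smul_fst, smul_eq_mul, mul_one] using h
    · simpa using ((hasDerivAt_id (0 : ℝ)).const_add p.1).const_mul (2 * ε)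
  have hY : 0 ≤ Yd (Yd H) p := by
    refine second_deriv_line_ge (q' := fun _ => 0)
      (W := fun η : H1 => ((0 : ℝ), (1 : ℝ), -2 * η.1)) hu (by fun_prop) (by simp) ?_ ?_ hloc
    · intro s
      simpa using hasDerivAt_const s (ε * p.1 ^ 2)
    · exact hasDerivAt_const _ _
  have := hHh p hpΩ
  unfold kohn at this
  linarith

/-- The conjugate by left translation to `ξ` of the anisotropic dilation of factor `l`,
as a linear map in the coordinates `η - ξ`. -/
def dilation (ξ : H1) (l : ℝ) : H1 →ₗ[ℝ] H1 where
  toFun v := (l * v.1, l * v.2.1, l ^ 2 * v.2.2 + 2 * (l ^ 2 - l) * (ξ.1 * v.2.1 - ξ.2.1 * v.1))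
  map_add' v w := by ext <;> simp <;> ring
  map_smul' a v := by ext <;> simp <;> ring

lemma det_dilation (ξ : H1) (l : ℝ) : LinearMap.det (dilation ξ l) = l ^ 4 := by
  let e : H1 ≃ₗ[ℝ] (Fin 3 → ℝ) :=
    { toFun := fun v => ![v.1, v.2.1, v.2.2]
      invFun := fun f => (f 0, f 1, f 2)
      map_add' := fun v w => by ext i; fin_cases i <;> simp
      map_smul' := fun a v => by ext i; fin_cases i <;> simp
      left_inv := fun v => by simp
      right_inv := fun f => by ext i; fin_cases i <;> simp }
  let b := Module.Basis.ofEquivFun e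
  rw [← LinearMap.det_toMatrix b, Matrix.det_fin_three]
  simp [LinearMap.toMatrix_apply, b, e, dilation]
  ring

lemma kd_dilation (ξ v : H1) {l : ℝ} (hl : 0 ≤ l) :
    kd ξ (ξ + dilation ξ l v) = l * kd ξ (ξ + v) := by
  have h4 : l = (l ^ 4) ^ ((1 : ℝ) / 4) := by
    rw [← Real.rpow_natCast, ← Real.rpow_mul hl]; norm_num
  unfold kd ρH
  conv_rhs => rw [h4]
  rw [← Real.mul_rpow (by positivity) (by positivity)]
  congr 1
  simp only [hmul, hinv, dilation, LinearMap.coe_mk, AddHom.coe_mk, Prod.fst_add, Prod.snd_add]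
  ring

/-- Lebesgue measure on the Heisenberg group is a Haar measure of its underlying vector group. -/
instance isAddHaarMeasure_volume_H1 : (volume : Measure H1).IsAddHaarMeasure :=
  Measure.prod.instIsAddHaarMeasure (volume : Measure ℝ)
    ((volume : Measure ℝ).prod (volume : Measure ℝ))

/-- Koranyi balls have volume homogeneous of degree 4 in the radius. -/
lemma volume_kball_mul (ξ : H1) {l : ℝ} (hl : 0 < l) (r : ℝ) :
    volume (kball ξ (l * r)) = ENNReal.ofReal (l ^ 4) * volume (kball ξ r) := by
  have hdet : LinearMap.det (dilation ξ l) ≠ 0 := by rw [det_dilation]; positivity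
  have hpre : (fun v => ξ + v) ⁻¹' kball ξ r =
      dilation ξ l ⁻¹' ((fun v => ξ + v) ⁻¹' kball ξ (l * r)) := by
    ext v
    simp only [kball, Set.mem_preimage, Set.mem_ofPred_eq, kd_dilation ξ v hl.le]
    exact (mul_lt_mul_iff_right₀ hl).symm
  rw [← measure_preimage_add volume ξ (kball ξ r), hpre,
    Measure.addHaar_preimage_linearMap volume hdet, det_dilation, measure_preimage_add,
    ← mul_assoc, ← ENNReal.ofReal_mul (by positivity), abs_of_pos (by positivity),
    mul_inv_cancel₀ (by positivity), ENNReal.ofReal_one, one_mul]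

/-- A preconnected set meeting both a set and its complement meets its frontier. -/
lemma IsPreconnected.exists_mem_frontier {X : Type*} [TopologicalSpace X] {s A : Set X}
    (hs : IsPreconnected s) (h : (s ∩ A).Nonempty) (h' : (s ∩ Aᶜ).Nonempty) :
    (s ∩ frontier A).Nonempty := by
  by_contra! hn
  have hf : ∀ x ∈ s, x ∉ frontier A := fun x hx hxf =>
    (Set.ext_iff.1 hn x).1 ⟨hx, hxf⟩
  have hcl : ∀ x ∈ s, x ∈ closure A → x ∈ interior A := fun x hx hxc => by
    by_contra hi
    exact hf x hx ⟨hxc, hi⟩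
  obtain ⟨x, hx⟩ := h
  obtain ⟨y, hy⟩ := h'
  obtain ⟨z, -, hzi, hzc⟩ := hs (interior A) (closure A)ᶜ isOpen_interior
    isClosed_closure.isOpen_compl
    (fun z hz => (em (z ∈ closure A)).imp (hcl z hz) id)
    ⟨x, hx.1, hcl x hx.1 (subset_closure hx.2)⟩
    ⟨y, hy.1, fun hyc => hy.2 (interior_subset (hcl y hy.1 hyc))⟩
  exact hzc (subset_closure (interior_subset hzi))

/-- A Koranyi ball centred in `Ω` that misses the boundary of `Ω` lies in `Ω`. -/
lemma kball_subset_of_forall_frontier {Ω : Set H1} {ξ : H1} (hξ : ξ ∈ Ω) {m : ℝ}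
    (hm : ∀ η ∈ frontier Ω, m ≤ kd ξ η) : kball ξ m ⊆ Ω := by
  intro η hη
  by_contra hn
  have hcont : Continuous fun s : ℝ => ξ + dilation ξ s (η - ξ) := by
    simp only [dilation, LinearMap.coe_mk, AddHom.coe_mk]
    fun_prop
  have hpre : IsPreconnected ((fun s : ℝ => ξ + dilation ξ s (η - ξ)) '' Set.Icc 0 1) :=
    isPreconnected_Icc.image _ hcont.continuousOn
  obtain ⟨_, ⟨s, hs, rfl⟩, hf⟩ := hpre.exists_mem_frontier (A := Ω)
    ⟨ξ, ⟨0, by simp, by simp [dilation]⟩, hξ⟩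
    ⟨η, ⟨1, by simp, by simp [dilation]⟩, hn⟩
  have h1 := hm _ hf
  simp only [kd_dilation ξ _ hs.1, add_sub_cancel] at h1
  have h2 : kd ξ η < m := hη
  nlinarith [hs.1, hs.2, kd_nonneg ξ η]

/-- |B(ξ, r_Ω(ξ))| ≤ α_Ω(ξ)⁴·|Ω|, where
α_Ω(ξ) = (sup_{η∈∂Ω} d(ξ,η))/(inf_{η∈∂Ω} d(ξ,η)). -/
theorem harmonic_radius_ball_volume_bound (Ω : Set H1) (hΩo : IsOpen Ω)
    (hΩb : Bornology.IsBounded Ω) (hsm : smoothBdry Ω)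
    (hu1 : uebp Ω) (hu2 : uebp (Set.univ \ closure Ω))
    (ξ : H1) (hξ : ξ ∈ Ω) (H : H1 → ℝ)
    (hHc : ContinuousOn H (closure Ω)) (hHd : ContDiffOn ℝ 2 H Ω)
    (hHh : ∀ η ∈ Ω, kohn H η = 0)
    (hHb : ∀ η ∈ frontier Ω, H η = Γξ ξ η)
    (hHξ : 0 < H ξ) :
    volume (kball ξ (1 / Real.sqrt (8 * π * H ξ))) ≤
      ENNReal.ofReal ((sSup (kd ξ '' frontier Ω) / sInf (kd ξ '' frontier Ω)) ^ 4) *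
        volume Ω := by
  have hcpt : IsCompact (frontier Ω) :=
    hΩb.isCompact_closure.of_isClosed_subset isClosed_frontier frontier_subset_closure
  have hne : (frontier Ω).Nonempty := by
    rw [nonempty_frontier_iff]
    refine ⟨⟨ξ, hξ⟩, fun h => ?_⟩
    rw [h] at hΩb
    exact NoncompactSpace.noncompact_univ (X := H1)
      (by simpa using hΩb.isCompact_closure)
  have himg : IsCompact (kd ξ '' frontier Ω) := hcpt.image (continuous_kd ξ)
  set M := sSup (kd ξ '' frontier Ω)
  set m := sInf (kd ξ '' frontier Ω)
  have hM : ∀ η ∈ frontier Ω, kd ξ η ≤ M := fun η hη => le_csSup himg.bddAbove ⟨η, hη, rfl⟩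
  have hm : ∀ η ∈ frontier Ω, m ≤ kd ξ η := fun η hη => csInf_le himg.bddBelow ⟨η, hη, rfl⟩
  have hpos : ∀ η ∈ frontier Ω, 0 < kd ξ η := by
    refine fun η hη => kd_pos ?_
    rintro rfl
    rw [hΩo.frontier_eq] at hη
    exact hη.2 hξ
  have hm0 : 0 < m := by
    obtain ⟨η, hη, h⟩ := himg.sInf_mem (hne.image _)
    exact (hpos η hη).trans_eq h
  have hM0 : 0 < M := by
    obtain ⟨η, hη⟩ := hne
    exact (hpos η hη).trans_le (hM η hη)
  have hmin : 1 / (8 * π * M ^ 2) ≤ H ξ := by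
    refine kohn_min_principle hΩo hΩb hHc hHd (fun η hη => (hHh η hη).le) (fun η hη => ?_) hξ
    rw [hHb η hη, Γξ]
    have := hpos η hη
    have := hM η hη
    gcongr
  have hr : 1 / Real.sqrt (8 * π * H ξ) ≤ M := by
    rw [div_le_iff₀ (by positivity)] at hmin
    rw [div_le_iff₀ (by positivity), ← Real.sqrt_sq hM0.le, ← Real.sqrt_mul (sq_nonneg M),
      Real.one_le_sqrt]
    linarith
  calc volume (kball ξ (1 / Real.sqrt (8 * π * H ξ)))
      ≤ volume (kball ξ (M / m * m)) := by
        rw [div_mul_cancel₀ M hm0.ne']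
        exact measure_mono fun η (hη : kd ξ η < _) => hη.trans_le hr
    _ = ENNReal.ofReal ((M / m) ^ 4) * volume (kball ξ m) :=
        volume_kball_mul ξ (div_pos hM0 hm0) m
    _ ≤ ENNReal.ofReal ((M / m) ^ 4) * volume Ω := by
        gcongr
        exact kball_subset_of_forall_frontier hξ hm
end
end
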